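/- arXiv:0801.3872 — 2 statements merged into one kernel-verified Lean document; each statement's English description precedes it below -/
import Mathlib

section
/- For the spin-1/2 particle in a rotating magnetic field, the 2-norm of the adiabatic error operator equals ‖Q(t)U(t)P(0)‖ = |(ω₀ sin θ/ω̄) sin(ω̄t/2)|, where ω̄ = √(ω₀² + ω² + 2ω₀ω cos θ) ≠ 0, P(0) = [[1,0],[0,0]], Q(t) = [[0,0],[0,1]], and U(t) is the exact unitary evolution operator of the system. -/
/-- The operator 2-norm of a `2 × 2` matrix whose only nonzero entry is the lower left one. -/
theorem norm_toEuclideanCLM_lower_left (b : ℂ) :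
    ‖Matrix.toEuclideanCLM (n := Fin 2) (𝕜 := ℂ) !![0, 0; b, 0]‖ = ‖b‖ := by
  have key : ∀ x : EuclideanSpace ℂ (Fin 2),
      ‖Matrix.toEuclideanCLM (n := Fin 2) (𝕜 := ℂ) !![0, 0; b, 0] x‖ = ‖b‖ * ‖x 0‖ := by
    intro x
    rw [EuclideanSpace.norm_eq]
    simp [Fin.sum_univ_two, Matrix.ofLp_toEuclideanCLM, Matrix.mulVec, dotProduct]
    exact Real.sqrt_sq (by positivity)
  apply le_antisymm
  · refine ContinuousLinearMap.opNorm_le_bound _ (norm_nonneg b) fun x => ?_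
    rw [key]
    exact mul_le_mul_of_nonneg_left (PiLp.norm_apply_le x 0) (norm_nonneg b)
  · have h := (Matrix.toEuclideanCLM (n := Fin 2) (𝕜 := ℂ) !![0, 0; b, 0]).le_opNorm
      (EuclideanSpace.single 0 1)
    rw [key] at h
    simpa using h

/-- The solution of the constant-coefficient system `x' = (i/2) (k x + m y)`,
`y' = (i/2) (m x - k y)` with `x 0 = 1`, `y 0 = 0`: its second component. -/
theorem rabi_second_component {x y : ℝ → ℂ} {k m o : ℝ} (ho : o ≠ 0)
    (hkm : k ^ 2 + m ^ 2 = o ^ 2)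
    (hx : ∀ t, HasDerivAt x (Complex.I / 2 * (k * x t + m * y t)) t)
    (hy : ∀ t, HasDerivAt y (Complex.I / 2 * (m * x t - k * y t)) t)
    (hx0 : x 0 = 1) (hy0 : y 0 = 0) (t : ℝ) :
    y t = Complex.I * ((m / o * Real.sin (o * t / 2) : ℝ) : ℂ) := by
  have hoC : (o : ℂ) ≠ 0 := by exact_mod_cast ho
  have hkmC : (k : ℂ) ^ 2 + (m : ℂ) ^ 2 = (o : ℂ) ^ 2 := by exact_mod_cast hkm
  have hlin : ∀ t : ℝ, HasDerivAt (fun s : ℝ => o * s / 2) (o / 2) t := fun t => by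
    simpa using ((hasDerivAt_id t).const_mul o).div_const 2
  have hcos : ∀ t : ℝ, HasDerivAt (fun s : ℝ => ((Real.cos (o * s / 2) : ℝ) : ℂ))
      ((-Real.sin (o * t / 2) * (o / 2) : ℝ) : ℂ) t := fun t => (hlin t).cos.ofReal_comp
  have hsin : ∀ t : ℝ, HasDerivAt (fun s : ℝ => ((Real.sin (o * s / 2) : ℝ) : ℂ))
      ((Real.cos (o * t / 2) * (o / 2) : ℝ) : ℂ) t := fun t => (hlin t).sin.ofReal_comp
  let f : ℝ → ℂ := fun s => (Real.cos (o * s / 2) : ℝ) * x s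
    - Complex.I / o * ((Real.sin (o * s / 2) : ℝ) * (k * x s + m * y s))
  let g : ℝ → ℂ := fun s => (Real.cos (o * s / 2) : ℝ) * y s
    - Complex.I / o * ((Real.sin (o * s / 2) : ℝ) * (m * x s - k * y s))
  have hf : ∀ s, HasDerivAt f 0 s := fun s => by
    refine (((hcos s).mul (hx s)).sub (((hsin s).mul
      (((hx s).const_mul (k : ℂ)).add ((hy s).const_mul (m : ℂ)))).const_mul
        (Complex.I / o))).congr_deriv ?_
    simp only [Complex.ofReal_mul, Complex.ofReal_neg, Complex.ofReal_div, Complex.ofReal_ofNat,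
      Pi.add_apply]
    field_simp
    linear_combination (-(Real.sin (o * s / 2) : ℂ) * x s * Complex.I ^ 2) * hkmC
      - (Real.sin (o * s / 2) : ℂ) * x s * o ^ 2 * Complex.I_sq
  have hg : ∀ s, HasDerivAt g 0 s := fun s => by
    refine (((hcos s).mul (hy s)).sub (((hsin s).mul
      (((hx s).const_mul (m : ℂ)).sub ((hy s).const_mul (k : ℂ)))).const_mul
        (Complex.I / o))).congr_deriv ?_
    simp only [Complex.ofReal_mul, Complex.ofReal_neg, Complex.ofReal_div, Complex.ofReal_ofNat,
      Pi.sub_apply]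
    field_simp
    linear_combination (-(Real.sin (o * s / 2) : ℂ) * y s * Complex.I ^ 2) * hkmC
      - (Real.sin (o * s / 2) : ℂ) * y s * o ^ 2 * Complex.I_sq
  have hft : f t = 1 := by
    rw [is_const_of_deriv_eq_zero (fun s => (hf s).differentiableAt) (fun s => (hf s).deriv) t 0]
    simp [f, hx0]
  have hgt : g t = 0 := by
    rw [is_const_of_deriv_eq_zero (fun s => (hg s).differentiableAt) (fun s => (hg s).deriv) t 0]
    simp [g, hy0]
  have hcs : (Real.cos (o * t / 2) : ℂ) ^ 2 + (Real.sin (o * t / 2) : ℂ) ^ 2 = 1 := by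
    exact_mod_cast Real.cos_sq_add_sin_sq (o * t / 2)
  have hinv : y t = Real.cos (o * t / 2) * g t
      + Complex.I / o * (Real.sin (o * t / 2) * (m * f t - k * g t)) := by
    simp only [f, g]
    field_simp
    linear_combination (-y t * o ^ 2) * hcs
      + (Real.sin (o * t / 2) : ℂ) ^ 2 * y t * Complex.I ^ 2 * hkmC
      + (Real.sin (o * t / 2) : ℂ) ^ 2 * y t * o ^ 2 * Complex.I_sq
  rw [hinv, hft, hgt]
  push_cast
  ring

/-- For the spin-1/2 particle in a rotating magnetic field, the 2-norm of the
adiabatic error operator equals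
`‖Q U(t) P‖ = |(ω₀ sin θ / ω̄) sin(ω̄ t / 2)|`, where
`ω̄ = √(ω₀² + ω² + 2ω₀ω cos θ) ≠ 0`, `P = [[1,0],[0,0]]`, `Q = [[0,0],[0,1]]`,
and `U(t)` is the exact unitary evolution operator of the system (the matrix
2-norm is the norm of the associated operator on `ℂ²`). -/
theorem rotating_field_adiabatic_error_norm
    (ω₀ ω θ obar : ℝ)
    (hobar : obar = Real.sqrt (ω₀^2 + ω^2 + 2 * ω₀ * ω * Real.cos θ))
    (hne : obar ≠ 0)
    (H U : ℝ → Matrix (Fin 2) (Fin 2) ℂ)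
    (hH : ∀ t : ℝ, H t = (-(ω₀ : ℂ) / 2) •
      !![((Real.cos θ : ℝ) : ℂ),
           Complex.exp (-Complex.I * ((ω * t : ℝ) : ℂ)) * ((Real.sin θ : ℝ) : ℂ);
         Complex.exp (Complex.I * ((ω * t : ℝ) : ℂ)) * ((Real.sin θ : ℝ) : ℂ),
           -((Real.cos θ : ℝ) : ℂ)])
    -- `U` is the exact solution of Schrödinger's equation
    (hU0 : U 0 = 1)
    (hU : ∀ (t : ℝ) (i j : Fin 2),
      HasDerivAt (fun t' => U t' i j) (((-Complex.I) • (H t * U t)) i j) t) :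
    ∀ t : ℝ,
      ‖Matrix.toEuclideanCLM (n := Fin 2) (𝕜 := ℂ)
          ((!![0, 0; 0, 1] : Matrix (Fin 2) (Fin 2) ℂ) * U t * !![1, 0; 0, 0])‖ =
        |ω₀ * Real.sin θ / obar * Real.sin (obar * t / 2)| := by
  intro t
  have hr : 0 ≤ ω₀ ^ 2 + ω ^ 2 + 2 * ω₀ * ω * Real.cos θ := by
    nlinarith [sq_nonneg (ω + ω₀ * Real.cos θ), sq_nonneg (ω₀ * Real.sin θ),
      Real.sin_sq_add_cos_sq θ]
  have hkm : (ω + ω₀ * Real.cos θ) ^ 2 + (ω₀ * Real.sin θ) ^ 2 = obar ^ 2 := by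
    rw [hobar, Real.sq_sqrt hr]
    linear_combination ω₀ ^ 2 * Real.sin_sq_add_cos_sq θ
  have hexp : ∀ (c : ℂ) (s : ℝ), HasDerivAt (fun r : ℝ => Complex.exp (c * (r : ℂ)))
      (Complex.exp (c * (s : ℂ)) * c) s := fun c s => by
    simpa using ((Complex.ofRealCLM.hasDerivAt (x := s)).const_mul c).cexp
  set p : ℂ := Complex.I * ω / 2 with hp
  have hpos : ∀ s : ℝ, Complex.exp (Complex.I * ((ω * s : ℝ) : ℂ)) =
      Complex.exp (p * s) * Complex.exp (p * s) := fun s => by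
    rw [← Complex.exp_add]; congr 1; rw [hp]; push_cast; ring
  have hneg : ∀ s : ℝ, Complex.exp (-Complex.I * ((ω * s : ℝ) : ℂ)) =
      Complex.exp (-p * s) * Complex.exp (-p * s) := fun s => by
    rw [← Complex.exp_add]; congr 1; rw [hp]; push_cast; ring
  have hinv : ∀ s : ℝ, Complex.exp (p * s) * Complex.exp (-p * s) = 1 := fun s => by
    rw [← Complex.exp_add, ← add_mul, add_neg_cancel, zero_mul, Complex.exp_zero]
  -- In the frame rotating with the field the equation has constant coefficients.
  have hy := rabi_second_component (x := fun s => Complex.exp (p * s) * U s 0 0)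
    (y := fun s => Complex.exp (-p * s) * U s 1 0) hne hkm
    (fun s => by
      refine ((hexp p s).mul (hU s 0 0)).congr_deriv ?_
      rw [hH]
      simp only [Matrix.smul_apply, Matrix.mul_apply, Fin.sum_univ_two, Matrix.of_apply,
        Matrix.cons_val', Matrix.cons_val_zero, Matrix.cons_val_one, Matrix.cons_val_fin_one,
        smul_eq_mul, hpos, hneg]
      push_cast
      linear_combination (Complex.exp (p * s) * U s 0 0) * hp
        + (Complex.I / 2 * ω₀ * Complex.sin θ * U s 1 0 * Complex.exp (-p * s)) * hinv s)
    (fun s => by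
      refine ((hexp (-p) s).mul (hU s 1 0)).congr_deriv ?_
      rw [hH]
      simp only [Matrix.smul_apply, Matrix.mul_apply, Fin.sum_univ_two, Matrix.of_apply,
        Matrix.cons_val', Matrix.cons_val_zero, Matrix.cons_val_one, Matrix.cons_val_fin_one,
        smul_eq_mul, hpos, hneg]
      push_cast
      linear_combination (-Complex.exp (-p * s) * U s 1 0) * hp
        + (Complex.I / 2 * ω₀ * Complex.sin θ * U s 0 0 * Complex.exp (p * s)) * hinv s)
    (by simp [hU0]) (by simp [hU0]) t
  have hmat : (!![0, 0; 0, 1] : Matrix (Fin 2) (Fin 2) ℂ) * U t * !![1, 0; 0, 0] =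
      !![0, 0; U t 1 0, 0] := by
    ext i j
    fin_cases i <;> fin_cases j <;> simp [Matrix.mul_apply, Matrix.vecMul, dotProduct]
  have hphase : ‖Complex.exp (-p * t)‖ = 1 := by
    rw [Complex.norm_exp]
    simp [hp]
  have hnorm := congrArg norm hy
  rw [norm_mul, norm_mul, hphase, Complex.norm_I, one_mul, one_mul, Complex.norm_real,
    Real.norm_eq_abs] at hnorm
  rw [hmat, norm_toEuclideanCLM_lower_left, hnorm]
end

section
/- Let U(s) solve U̇(s) = −iτ H(s) U(s) and U_A(s) solve U̇_A(s) = −iτ H_A(s) U_A(s), both with initial value I, where H_A(s) = H(s) + (i/τ)[Ṗ(s), P(s)]. Then the wave operator W(s) = U_A(s)† U(s) satisfies Ẇ(s) = −U_A(s)† [Ṗ(s), P(s)] U_A(s) W(s), and consequently the integral equation W(s) = I − ∫₀ˢ U_A(r)† [Ṗ(r), P(r)] U_A(r) W(r) dr. -/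
/-- A solution of `V̇ = G V`, `V 0 = 1`, with `G` continuous and skew-adjoint on `[0, 1]`, is a
coisometry at every time. -/
theorem mul_star_self_eq_one_of_hasDerivAt {A : Type*} [CStarAlgebra A] {G V : ℝ → A}
    (hG : ContinuousOn G (Set.Icc 0 1)) (hskew : ∀ s ∈ Set.Icc (0:ℝ) 1, star (G s) = -G s)
    (hV0 : V 0 = 1) (hV : ∀ s ∈ Set.Icc (0:ℝ) 1, HasDerivAt V (G s * V s) s) :
    ∀ s ∈ Set.Icc (0:ℝ) 1, V s * star (V s) = 1 := by
  obtain ⟨C, hC⟩ := isCompact_Icc.exists_bound_of_continuousOn hG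
  have hderiv : ∀ s ∈ Set.Icc (0:ℝ) 1, HasDerivAt (fun t => V t * star (V t))
      (G s * (V s * star (V s)) - V s * star (V s) * G s) s := by
    intro s hs
    refine HasDerivAt.congr_deriv ((hV s hs).mul (hV s hs).star) ?_
    rw [star_mul, hskew s hs]
    noncomm_ring
  have hlip : ∀ t ∈ Set.Ico (0:ℝ) 1,
      LipschitzOnWith (2 * C).toNNReal (fun x => G t * x - x * G t) Set.univ := by
    intro t ht
    refine LipschitzOnWith.of_dist_le_mul fun x _ y _ => ?_
    have hCt := hC t (Set.Ico_subset_Icc_self ht)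
    have hC0 : 0 ≤ C := (norm_nonneg _).trans hCt
    rw [dist_eq_norm, dist_eq_norm, Real.coe_toNNReal _ (by positivity)]
    calc ‖G t * x - x * G t - (G t * y - y * G t)‖
        = ‖G t * (x - y) - (x - y) * G t‖ := by congr 1; noncomm_ring
      _ ≤ ‖G t‖ * ‖x - y‖ + ‖x - y‖ * ‖G t‖ :=
          (norm_sub_le _ _).trans (add_le_add (norm_mul_le _ _) (norm_mul_le _ _))
      _ = 2 * ‖G t‖ * ‖x - y‖ := by ring
      _ ≤ 2 * C * ‖x - y‖ := by gcongr
  have huniq := ODE_solution_unique_of_mem_Icc_right (v := fun t x => G t * x - x * G t)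
    (s := fun _ => Set.univ) (f := fun t => V t * star (V t)) (g := fun _ => (1 : A))
    hlip (fun s hs => (hderiv s hs).continuousAt.continuousWithinAt)
    (fun s hs => (hderiv s (Set.Ico_subset_Icc_self hs)).hasDerivWithinAt)
    (fun _ _ => Set.mem_univ _) continuousOn_const
    (fun s _ => by simpa using hasDerivWithinAt_const s (Set.Ici s) (1 : A))
    (fun _ _ => Set.mem_univ _) (by simp [hV0])
  exact huniq

/-- If `V̇ = G V` with `G` skew-adjoint, `V` is a coisometry and `U̇ = F U`, then `V† U` satisfies the
evolution equation with generator `-V† (G - F) V`. -/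
theorem hasDerivAt_star_mul {A : Type*} [CStarAlgebra A] {V U : ℝ → A} {G F : A} {s : ℝ}
    (hskew : star G = -G) (hVV : V s * star (V s) = 1)
    (hV : HasDerivAt V (G * V s) s) (hU : HasDerivAt U (F * U s) s) :
    HasDerivAt (fun t => star (V t) * U t)
      (-(star (V s) * (G - F) * V s * (star (V s) * U s))) s := by
  refine HasDerivAt.congr_deriv (hV.star.mul hU) ?_
  rw [mul_assoc _ (V s), ← mul_assoc (V s), hVV, one_mul, star_mul, hskew]
  noncomm_ring

/-- The derivative of a path that is self-adjoint on `[0, 1]` is self-adjoint there. -/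
theorem isSelfAdjoint_of_hasDerivAt {A : Type*} [CStarAlgebra A] {P P' : ℝ → A}
    (hP : ∀ s ∈ Set.Icc (0:ℝ) 1, IsSelfAdjoint (P s))
    (hP' : ∀ s ∈ Set.Icc (0:ℝ) 1, HasDerivAt P (P' s) s) :
    ∀ s ∈ Set.Icc (0:ℝ) 1, IsSelfAdjoint (P' s) := by
  intro s hs
  have hstar : HasDerivWithinAt P (star (P' s)) (Set.Icc 0 1) s :=
    (hP' s hs).star.hasDerivWithinAt.congr (fun t ht => (hP t ht).star_eq.symm)
      (hP s hs).star_eq.symm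
  exact (uniqueDiffOn_Icc zero_lt_one s hs).eq_deriv _ hstar (hP' s hs).hasDerivWithinAt


/-- Let `U` solve `U̇ = -iτ H U` and `U_A` solve `U̇_A = -iτ H_A U_A`, both
with initial value `1`, where `H_A(s) = H(s) + (i/τ)[Ṗ(s), P(s)]` for a
differentiable family of orthogonal projections `P(s)` commuting with `H(s)`.
Then the wave operator `W(s) = U_A(s)† U(s)` satisfies
`Ẇ(s) = -U_A(s)† [Ṗ(s), P(s)] U_A(s) W(s)` and consequently the integral
equation `W(s) = 1 - ∫₀ˢ U_A(r)† [Ṗ(r), P(r)] U_A(r) W(r) dr`. -/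
theorem wave_operator_integral_equation
    {ℋ : Type*} [NormedAddCommGroup ℋ] [InnerProductSpace ℂ ℋ] [CompleteSpace ℋ]
    (H H' H'' P P' HA U UA W : ℝ → ℋ →L[ℂ] ℋ)
    (τ : ℝ) (hτ : 0 < τ)
    -- self-adjointness and twice differentiability of `H`
    (hsa : ∀ s ∈ Set.Icc (0:ℝ) 1, IsSelfAdjoint (H s))
    (hH' : ∀ s ∈ Set.Icc (0:ℝ) 1, HasDerivAt H (H' s) s)
    (hH'' : ∀ s ∈ Set.Icc (0:ℝ) 1, HasDerivAt H' (H'' s) s)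
    -- `P s` is a differentiable family of orthogonal projections commuting
    -- with `H s`
    (hPidem : ∀ s ∈ Set.Icc (0:ℝ) 1, P s * P s = P s)
    (hPsa : ∀ s ∈ Set.Icc (0:ℝ) 1, IsSelfAdjoint (P s))
    (hPH : ∀ s ∈ Set.Icc (0:ℝ) 1, H s * P s = P s * H s)
    (hP' : ∀ s ∈ Set.Icc (0:ℝ) 1, HasDerivAt P (P' s) s)
    (hP'cont : Continuous P')
    -- the Avron Hamiltonian
    (hHA : ∀ s, HA s = H s + (Complex.I / (τ : ℂ)) • (P' s * P s - P s * P' s))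
    -- Schrödinger equations
    (hU0 : U 0 = 1)
    (hU : ∀ s ∈ Set.Icc (0:ℝ) 1,
      HasDerivAt U ((-(τ : ℂ) * Complex.I) • (H s * U s)) s)
    (hUA0 : UA 0 = 1)
    (hUA : ∀ s ∈ Set.Icc (0:ℝ) 1,
      HasDerivAt UA ((-(τ : ℂ) * Complex.I) • (HA s * UA s)) s)
    -- the wave operator
    (hW : ∀ s, W s = star (UA s) * U s) :
    (∀ s ∈ Set.Icc (0:ℝ) 1,
      HasDerivAt W
        (-(star (UA s) * (P' s * P s - P s * P' s) * UA s * W s)) s) ∧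
    (∀ s ∈ Set.Icc (0:ℝ) 1,
      W s = 1 - ∫ r in (0:ℝ)..s,
        star (UA r) * (P' r * P r - P r * P' r) * UA r * W r) := by
  have hτ' : (τ : ℂ) ≠ 0 := by exact_mod_cast hτ.ne'
  have hP'sa := isSelfAdjoint_of_hasDerivAt hPsa hP'
  have hPcont : ContinuousOn P (Set.Icc 0 1) := fun s hs =>
    (hP' s hs).continuousAt.continuousWithinAt
  have hHcont : ContinuousOn H (Set.Icc 0 1) := fun s hs =>
    (hH' s hs).continuousAt.continuousWithinAt
  have hKcont : ContinuousOn (fun s => P' s * P s - P s * P' s) (Set.Icc 0 1) :=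
    (hP'cont.continuousOn.mul hPcont).sub (hPcont.mul hP'cont.continuousOn)
  have hGcont : ContinuousOn (fun s => (-(τ : ℂ) * Complex.I) • HA s) (Set.Icc 0 1) := by
    simp only [hHA]
    exact (hHcont.add (hKcont.const_smul (Complex.I / (τ : ℂ)))).const_smul (-(τ : ℂ) * Complex.I)
  have hHAsa : ∀ s ∈ Set.Icc (0:ℝ) 1, star (HA s) = HA s := by
    intro s hs
    rw [hHA, star_add, star_smul, star_sub, star_mul, star_mul, (hsa s hs).star_eq,
      (hPsa s hs).star_eq, (hP'sa s hs).star_eq, ← neg_sub (P' s * P s), smul_neg, ← neg_smul]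
    congr 2
    simp [neg_div]
  have hstarc : star (-(τ : ℂ) * Complex.I) = -(-(τ : ℂ) * Complex.I) := by simp
  have hskew : ∀ s ∈ Set.Icc (0:ℝ) 1, star ((-(τ : ℂ) * Complex.I) • HA s)
      = -((-(τ : ℂ) * Complex.I) • HA s) := by
    intro s hs
    rw [star_smul, hHAsa s hs, hstarc, neg_smul]
  have hcoisom : ∀ s ∈ Set.Icc (0:ℝ) 1, UA s * star (UA s) = 1 :=
    mul_star_self_eq_one_of_hasDerivAt hGcont hskew hUA0
      (fun s hs => by simpa only [smul_mul_assoc] using hUA s hs)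
  have hWderiv : ∀ s ∈ Set.Icc (0:ℝ) 1, HasDerivAt W
      (-(star (UA s) * (P' s * P s - P s * P' s) * UA s * W s)) s := by
    intro s hs
    have hdiff : (-(τ : ℂ) * Complex.I) • HA s - (-(τ : ℂ) * Complex.I) • H s
        = P' s * P s - P s * P' s := by
      have hc : -(τ : ℂ) * Complex.I * (Complex.I / τ) = 1 := by
        field_simp
        simp
      rw [← smul_sub, hHA, add_sub_cancel_left, smul_smul, hc, one_smul]
    have hWfun : W = fun t => star (UA t) * U t := funext hW
    rw [hWfun, ← hdiff]
    exact hasDerivAt_star_mul (hskew s hs) (hcoisom s hs)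
      (by simpa only [smul_mul_assoc] using hUA s hs)
      (by simpa only [smul_mul_assoc] using hU s hs)
  refine ⟨hWderiv, fun s hs => ?_⟩
  have hsub : Set.uIcc 0 s ⊆ Set.Icc (0:ℝ) 1 := by
    rw [Set.uIcc_of_le hs.1]
    exact Set.Icc_subset_Icc_right hs.2
  have hUAcont : ContinuousOn UA (Set.Icc 0 1) := fun t ht =>
    (hUA t ht).continuousAt.continuousWithinAt
  have hWcont : ContinuousOn W (Set.Icc 0 1) := fun t ht =>
    (hWderiv t ht).continuousAt.continuousWithinAt
  have hint := intervalIntegral.integral_eq_sub_of_hasDerivAt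
    (fun t ht => hWderiv t (hsub ht))
    ((((hUAcont.star.mul hKcont).mul hUAcont).mul hWcont).neg.mono hsub).intervalIntegrable
  have hW0 : W 0 = 1 := by simp [hW, hU0, hUA0]
  rw [intervalIntegral.integral_neg, hW0] at hint
  rw [sub_eq_add_neg, hint]
  abel
end
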